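/- arXiv:1504.00168 — 3 statements merged into one kernel-verified Lean document; each statement's English description precedes it below -/
import Mathlib

section
/- For a totally separated $R$-module $M$ the following are equivalent: (i) the $\mathfrak m$-adic completion $\widehat M$ is totally separated; (ii) the extension $M \subseteq \widehat M$ is strictly pure-essential; (iii) for every finitely generated $R$-module $X$ the canonical map $\widehat{X \otimes_R M} \to X \otimes_R \widehat M$ is an isomorphism; (iv) for every pure monomorphism $\alpha: M \to Y$ with $Y$ separated, the induced map $\widehat\alpha: \widehat M \to \widehat Y$ of completions is a pure monomorphism. -/
/- Throughout, `(R, 𝔪)` is a commutative noetherian local ring and all modules are `R`-modules.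
`AdicCompletion (maximalIdeal R) M` is the `𝔪`-adic completion `lim M/𝔪^n M` and
`IsHausdorff (maximalIdeal R) M` says that `M` is (`𝔪`-adically) separated. -/

open TensorProduct IsLocalRing

universe u

section Definitions

variable (R : Type u) [CommRing R]

/-- A linear map is a *pure monomorphism* if it is injective and remains injective after
tensoring with an arbitrary module. -/
def IsPureMono {M N : Type u} [AddCommGroup M] [Module R M] [AddCommGroup N] [Module R N]
    (f : M →ₗ[R] N) : Prop :=
  Function.Injective f ∧
    ∀ (X : Type u) [AddCommGroup X] [Module R X], Function.Injective (LinearMap.lTensor X f)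

/-- A module `N` is *pure-injective* if every pure monomorphism out of `N` splits. -/
def IsPureInjective (N : Type u) [AddCommGroup N] [Module R N] : Prop :=
  ∀ (Y : Type u) [AddCommGroup Y] [Module R Y] (f : N →ₗ[R] Y),
    IsPureMono R f → ∃ g : Y →ₗ[R] N, g ∘ₗ f = LinearMap.id

/-- A submodule `A ⊆ B` is *pure* if its inclusion is a pure monomorphism. -/
def IsPureSubmodule {B : Type u} [AddCommGroup B] [Module R B] (A : Submodule R B) : Prop :=
  IsPureMono R A.subtype

/-- An extension `A ⊆ B` is *pure-essential* if `A` is pure in `B` and for every submodule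
`X ⊆ B` with `X ⊓ A = 0` such that `(X ⊕ A)/X` is pure in `B/X`, one has `X = 0`. -/
def IsPureEssential {B : Type u} [AddCommGroup B] [Module R B] (A : Submodule R B) : Prop :=
  IsPureSubmodule R A ∧
    ∀ X : Submodule R B, X ⊓ A = ⊥ → IsPureMono R (X.mkQ ∘ₗ A.subtype) → X = ⊥

/-- An extension `A ⊆ B` is *strictly pure-essential* if it is pure-essential and for every
extension `B ⊆ Y` in which `A` is pure in `Y`, also `B` is pure in `Y`. -/
def IsStrictlyPureEssential {B : Type u} [AddCommGroup B] [Module R B] (A : Submodule R B) :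
    Prop :=
  IsPureEssential R A ∧
    ∀ (Y : Type u) [AddCommGroup Y] [Module R Y] (g : B →ₗ[R] Y),
      Function.Injective g → IsPureMono R (g ∘ₗ A.subtype) → IsPureMono R g

/-- A module `M` over a local ring is *totally separated* if `X ⊗[R] M` is `𝔪`-adically
separated for every finitely generated `R`-module `X`. -/
def IsTotallySeparatedModule [IsLocalRing R] (M : Type u) [AddCommGroup M] [Module R M] :
    Prop :=
  ∀ (X : Type u) [AddCommGroup X] [Module R X] [Module.Finite R X],
    IsHausdorff (maximalIdeal R) (X ⊗[R] M)

end Definitions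

section Purity

variable {R : Type u} [CommRing R]

theorem isPureMono_of_finite {M N : Type u} [AddCommGroup M] [Module R M] [AddCommGroup N]
    [Module R N] (f : M →ₗ[R] N)
    (h : ∀ (X : Type u) [AddCommGroup X] [Module R X] [Module.Finite R X],
      Function.Injective (f.lTensor X)) : IsPureMono R f := by
  refine ⟨fun x y hxy => ?_, fun X _ _ => ?_⟩
  · have := @h R _ _ _ (1 ⊗ₜ x) (1 ⊗ₜ y) (by simp [hxy])
    simpa using congrArg (TensorProduct.lid R M) this
  · rw [injective_iff_map_eq_zero]
    intro t ht
    obtain ⟨P, hP, s, rfl⟩ := TensorProduct.exists_of_fg t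
    have hs : P.subtype.rTensor N (f.lTensor P s) = 0 := by
      rw [← ht, ← LinearMap.comp_apply, ← LinearMap.comp_apply, LinearMap.rTensor_comp_lTensor,
        LinearMap.lTensor_comp_rTensor]
    obtain ⟨Q, hPQ, hQ, h0⟩ := TensorProduct.eq_zero_of_fg_of_subtype_eq_zero hP hs
    have : Module.Finite R Q := Module.Finite.iff_fg.mpr hQ
    have h1 : f.lTensor Q ((Submodule.inclusion hPQ).rTensor M s) = 0 := by
      rw [← h0, ← LinearMap.comp_apply, ← LinearMap.comp_apply, LinearMap.rTensor_comp_lTensor,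
        LinearMap.lTensor_comp_rTensor]
    have h2 := (injective_iff_map_eq_zero _).mp (h Q) _ h1
    have h3 : P.subtype = Q.subtype ∘ₗ Submodule.inclusion hPQ := rfl
    rw [h3, LinearMap.rTensor_comp, LinearMap.comp_apply, h2, map_zero]

theorem isPureMono_comp_subtype_range_iff {M N P : Type u} [AddCommGroup M] [Module R M]
    [AddCommGroup N] [Module R N] [AddCommGroup P] [Module R P] {g : M →ₗ[R] N}
    (hg : Function.Injective g) (f : N →ₗ[R] P) :
    IsPureMono R (f ∘ₗ (LinearMap.range g).subtype) ↔ IsPureMono R (f ∘ₗ g) := by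
  let e := LinearEquiv.ofInjective g hg
  have he : f ∘ₗ g = (f ∘ₗ (LinearMap.range g).subtype) ∘ₗ e.toLinearMap := rfl
  have key (X : Type u) [AddCommGroup X] [Module R X] :
      Function.Injective ((f ∘ₗ g).lTensor X) ↔
        Function.Injective ((f ∘ₗ (LinearMap.range g).subtype).lTensor X) := by
    rw [he, LinearMap.lTensor_comp, LinearMap.coe_comp]
    exact Function.Injective.of_comp_iff' _ (e.lTensor X).bijective
  refine and_congr ?_ (forall_congr' fun X => forall_congr' fun _ => forall_congr' fun _ =>
    (key X).symm)
  rw [he, LinearMap.coe_comp _ e.toLinearMap]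
  exact (Function.Injective.of_comp_iff' _ e.bijective).symm

theorem IsPureMono.of_comp {M N P : Type u} [AddCommGroup M] [Module R M] [AddCommGroup N]
    [Module R N] [AddCommGroup P] [Module R P] {f : M →ₗ[R] N} {g : N →ₗ[R] P}
    (h : IsPureMono R (g ∘ₗ f)) : IsPureMono R f := by
  refine ⟨?_, fun X _ _ => ?_⟩
  · have := h.1
    rw [LinearMap.coe_comp] at this
    exact this.of_comp
  · have := h.2 X
    rw [LinearMap.lTensor_comp, LinearMap.coe_comp] at this
    exact this.of_comp

end Purity

section Adic

variable {R : Type u} [CommRing R]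

theorem apply_mem_smul_top (J : Ideal R) {M N : Type*} [AddCommGroup M] [Module R M]
    [AddCommGroup N] [Module R N] (f : M →ₗ[R] N) {x : M} (hx : x ∈ (J • ⊤ : Submodule R M)) :
    f x ∈ (J • ⊤ : Submodule R N) := by
  have h := Submodule.mem_map_of_mem (f := f) hx
  rw [Submodule.map_smul''] at h
  exact Submodule.smul_mono le_rfl le_top h

theorem isHausdorff_of_injective {I : Ideal R} {M N : Type*} [AddCommGroup M] [Module R M]
    [AddCommGroup N] [Module R N] (f : M →ₗ[R] N) (hf : Function.Injective f)
    [IsHausdorff I N] : IsHausdorff I M := by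
  refine ⟨fun x hx => hf ?_⟩
  rw [map_zero]
  refine IsHausdorff.haus ‹_› _ fun n => ?_
  rw [SModEq.zero]
  exact apply_mem_smul_top _ f (SModEq.zero.mp (hx n))

theorem isPrecomplete_of_surjective {I : Ideal R} {M N : Type*} [AddCommGroup M] [Module R M]
    [AddCommGroup N] [Module R N] (f : M →ₗ[R] N) (hf : Function.Surjective f)
    [IsPrecomplete I M] : IsPrecomplete I N := by
  rw [← AdicCompletion.of_surjective_iff]
  intro y
  obtain ⟨x, rfl⟩ := AdicCompletion.map_surjective I hf y
  obtain ⟨z, rfl⟩ := AdicCompletion.of_surjective I M x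
  exact ⟨f z, rfl⟩

theorem isPrecomplete_pi_of_finite {I : Ideal R} {ι : Type*} [Finite ι] {M : ι → Type*}
    [∀ i, AddCommGroup (M i)] [∀ i, Module R (M i)] [∀ i, IsPrecomplete I (M i)] :
    IsPrecomplete I (∀ i, M i) := by
  classical
  have := Fintype.ofFinite ι
  rw [← AdicCompletion.of_surjective_iff]
  intro y
  choose x hx using fun i =>
    AdicCompletion.of_surjective I (M i) (AdicCompletion.piEquivOfFintype I M y i)
  refine ⟨x, (AdicCompletion.piEquivOfFintype I M).injective ?_⟩
  funext i
  rw [← hx, AdicCompletion.piEquivOfFintype_apply]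
  rfl

theorem ker_lTensor_mkQ_smul_top_le (J : Ideal R) (X M : Type*) [AddCommGroup X] [Module R X]
    [AddCommGroup M] [Module R M] :
    LinearMap.ker ((J • ⊤ : Submodule R M).mkQ.lTensor X) ≤ J • ⊤ := by
  rw [lTensor_mkQ]
  rintro _ ⟨t, rfl⟩
  induction t with
  | zero => simp
  | add a b ha hb => rw [map_add]; exact add_mem ha hb
  | tmul x y =>
    obtain ⟨y, hy⟩ := y
    rw [LinearMap.lTensor_tmul, Submodule.subtype_apply]
    refine Submodule.smul_induction_on (p := fun y => x ⊗ₜ[R] y ∈ (J • ⊤ : Submodule R (X ⊗[R] M)))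
      hy (fun r hr m _ => ?_) fun a b ha hb => ?_
    · rw [TensorProduct.tmul_smul]
      exact Submodule.smul_mem_smul hr trivial
    · rw [TensorProduct.tmul_add]
      exact add_mem ha hb

theorem ker_rTensor_mkQ_smul_top_le (J : Ideal R) (X M : Type*) [AddCommGroup X] [Module R X]
    [AddCommGroup M] [Module R M] :
    LinearMap.ker ((J • ⊤ : Submodule R X).mkQ.rTensor M) ≤ J • ⊤ := by
  intro t ht
  have h : TensorProduct.comm R X M t ∈ (J • ⊤ : Submodule R (M ⊗[R] X)) := by
    apply ker_lTensor_mkQ_smul_top_le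
    rw [LinearMap.mem_ker] at ht ⊢
    rw [← LinearMap.comm_comp_rTensor_comp_comm_eq]
    simp [ht]
  simpa using apply_mem_smul_top _ (TensorProduct.comm R M X).toLinearMap h

theorem smul_top_tensorProduct_eq_bot {J : Ideal R} {X : Type*} (M : Type*) [AddCommGroup X]
    [Module R X] [AddCommGroup M] [Module R M] (hX : (J • ⊤ : Submodule R X) = ⊥) :
    (J • ⊤ : Submodule R (X ⊗[R] M)) = ⊥ := by
  rw [eq_bot_iff, Submodule.smul_le]
  intro r hr t _
  rw [Submodule.mem_bot]
  induction t with
  | zero => simp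
  | add a b ha hb => rw [smul_add, ha trivial, hb trivial, add_zero]
  | tmul x y =>
    have : r • x = 0 := by
      rw [← Submodule.mem_bot R, ← hX]
      exact Submodule.smul_mem_smul hr trivial
    rw [TensorProduct.smul_tmul', this, TensorProduct.zero_tmul]

theorem smul_top_tensorProduct_comm_eq_bot {J : Ideal R} {M : Type*} (X : Type*) [AddCommGroup X]
    [Module R X] [AddCommGroup M] [Module R M] (hM : (J • ⊤ : Submodule R M) = ⊥) :
    (J • ⊤ : Submodule R (X ⊗[R] M)) = ⊥ := by
  have h := congrArg (Submodule.map (TensorProduct.comm R M X).toLinearMap)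
    (smul_top_tensorProduct_eq_bot X hM)
  rwa [Submodule.map_smul'', Submodule.map_top, LinearEquiv.range, Submodule.map_bot] at h

theorem smul_top_quotient_eq_bot (J : Ideal R) (M : Type*) [AddCommGroup M] [Module R M] :
    (J • ⊤ : Submodule R (M ⧸ (J • ⊤ : Submodule R M))) = ⊥ := by
  rw [← Submodule.range_mkQ, LinearMap.range_eq_map, ← Submodule.map_smul'', Submodule.mkQ_map_self]

theorem mem_smul_top_of_lTensor_of_mem (I : Ideal R) {X M : Type*} [AddCommGroup X] [Module R X]
    [AddCommGroup M] [Module R M] {n : ℕ} {s : X ⊗[R] M}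
    (hs : (AdicCompletion.of I M).lTensor X s ∈
      (I ^ n • ⊤ : Submodule R (X ⊗[R] AdicCompletion I M))) :
    s ∈ (I ^ n • ⊤ : Submodule R (X ⊗[R] M)) := by
  apply ker_lTensor_mkQ_smul_top_le
  have h0 := apply_mem_smul_top _ ((AdicCompletion.eval I M n).lTensor X) hs
  rw [smul_top_tensorProduct_comm_eq_bot X (smul_top_quotient_eq_bot (I ^ n) M),
    Submodule.mem_bot, ← LinearMap.comp_apply, ← LinearMap.lTensor_comp,
    AdicCompletion.eval_comp_of] at h0
  exact h0

theorem lTensor_of_injective_of_isHausdorff (I : Ideal R) (X M : Type*) [AddCommGroup X]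
    [Module R X] [AddCommGroup M] [Module R M] [IsHausdorff I (X ⊗[R] M)] :
    Function.Injective ((AdicCompletion.of I M).lTensor X) := by
  rw [injective_iff_map_eq_zero]
  intro s hs
  refine IsHausdorff.haus ‹_› s fun n => SModEq.zero.mpr (mem_smul_top_of_lTensor_of_mem I ?_)
  rw [hs]
  exact zero_mem _

theorem lTensor_incl_comp_of_injective_of_isHausdorff (I : Ideal R) (X M : Type*) [AddCommGroup X]
    [Module R X] [AddCommGroup M] [Module R M] [IsHausdorff I (X ⊗[R] M)] :
    Function.Injective ((AdicCompletion.incl I M ∘ₗ AdicCompletion.of I M).lTensor X) := by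
  rw [injective_iff_map_eq_zero]
  intro s hs
  refine IsHausdorff.haus ‹_› s fun n => SModEq.zero.mpr (ker_lTensor_mkQ_smul_top_le _ _ _ ?_)
  have : (I ^ n • ⊤ : Submodule R M).mkQ =
      LinearMap.proj n ∘ₗ (AdicCompletion.incl I M ∘ₗ AdicCompletion.of I M) := rfl
  rw [LinearMap.mem_ker, this, LinearMap.lTensor_comp, LinearMap.comp_apply, hs, map_zero]

theorem exists_sub_lTensor_of_mem {I : Ideal R} (hI : I.FG) {X M : Type*} [AddCommGroup X]
    [Module R X] [AddCommGroup M] [Module R M] (n : ℕ) (t : X ⊗[R] AdicCompletion I M) :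
    ∃ s : X ⊗[R] M, t - (AdicCompletion.of I M).lTensor X s ∈
      (I ^ n • ⊤ : Submodule R (X ⊗[R] AdicCompletion I M)) := by
  induction t with
  | zero => exact ⟨0, by simp⟩
  | add a b ha hb =>
    obtain ⟨s, hs⟩ := ha
    obtain ⟨s', hs'⟩ := hb
    refine ⟨s + s', ?_⟩
    rw [map_add, add_sub_add_comm]
    exact add_mem hs hs'
  | tmul x y =>
    obtain ⟨z, hz⟩ := Submodule.mkQ_surjective _ (AdicCompletion.eval I M n y)
    have h : y - AdicCompletion.of I M z ∈ (I ^ n • ⊤ : Submodule R (AdicCompletion I M)) := by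
      rw [AdicCompletion.pow_smul_top_eq_ker_eval hI, LinearMap.mem_ker, map_sub,
        AdicCompletion.eval_of, hz, sub_self]
    refine ⟨x ⊗ₜ z, ?_⟩
    rw [LinearMap.lTensor_tmul, ← TensorProduct.tmul_sub]
    exact apply_mem_smul_top _ (TensorProduct.mk R X (AdicCompletion I M) x) h

theorem AdicCompletion.isPrecomplete_tensorProduct {I : Ideal R} (hI : I.FG) (X M : Type*)
    [AddCommGroup X] [Module R X] [Module.Finite R X] [AddCommGroup M] [Module R M] :
    IsPrecomplete I (X ⊗[R] AdicCompletion I M) := by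
  obtain ⟨k, p, hp⟩ := Module.Finite.exists_fin' R X
  have := (AdicCompletion.isAdicComplete (M := M) hI).toIsPrecomplete
  have : IsPrecomplete I (Fin k → AdicCompletion I M) := isPrecomplete_pi_of_finite
  exact isPrecomplete_of_surjective
    (p.rTensor _ ∘ₗ (TensorProduct.comm R (AdicCompletion I M) (Fin k → R)).toLinearMap ∘ₗ
      (TensorProduct.piScalarRight R R (AdicCompletion I M) (Fin k)).symm.toLinearMap)
    ((LinearMap.rTensor_surjective _ hp).comp
      ((TensorProduct.comm R _ _).surjective.comp (LinearEquiv.surjective _)))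

theorem AdicCompletion.map_lTensor_of_bijective {I : Ideal R} (hI : I.FG) (X M : Type*)
    [AddCommGroup X] [Module R X] [AddCommGroup M] [Module R M] :
    Function.Bijective (AdicCompletion.map I ((AdicCompletion.of I M).lTensor X)) := by
  constructor
  · rw [injective_iff_map_eq_zero]
    intro x hx
    ext n
    obtain ⟨s, hs⟩ := Submodule.mkQ_surjective _ (x.val n)
    have h : (AdicCompletion.map I ((AdicCompletion.of I M).lTensor X) x).val n = 0 := by
      rw [hx]; rfl
    rw [AdicCompletion.map_val_apply, ← hs, Submodule.mkQ_apply, LinearMap.reduceModIdeal_apply,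
      Submodule.Quotient.mk_eq_zero] at h
    rw [← hs, Submodule.mkQ_apply]
    exact (Submodule.Quotient.mk_eq_zero _).mpr (mem_smul_top_of_lTensor_of_mem I h)
  · refine AdicCompletion.map_surjective_of_mkQ_comp_surjective fun y => ?_
    obtain ⟨t, rfl⟩ := Submodule.mkQ_surjective _ y
    obtain ⟨s, hs⟩ := exists_sub_lTensor_of_mem hI 1 t
    refine ⟨s, ((Submodule.Quotient.eq _).mpr ?_).symm⟩
    simpa using hs

theorem piRightHom_pi_bijective {ι κ : Type*} [Finite κ] (L : ι → Type*)
    [∀ i, AddCommGroup (L i)] [∀ i, Module R (L i)] :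
    Function.Bijective (TensorProduct.piRightHom R R (κ → R) L) := by
  classical
  have := Fintype.ofFinite κ
  have key (t : (κ → R) ⊗[R] (∀ i, L i)) (i : ι) (a : κ) :
      (TensorProduct.comm R _ _ ≪≫ₗ TensorProduct.piScalarRight R R (L i) κ)
        (TensorProduct.piRightHom R R (κ → R) L t i) a =
      (TensorProduct.comm R _ _ ≪≫ₗ TensorProduct.piScalarRight R R (∀ i, L i) κ) t a i := by
    induction t with
    | zero => simp
    | add s t hs ht => simp only [map_add, Pi.add_apply, hs, ht]
    | tmul x y => simp
  constructor
  · rw [injective_iff_map_eq_zero]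
    intro t ht
    rw [← (TensorProduct.comm R _ _ ≪≫ₗ
      TensorProduct.piScalarRight R R (∀ i, L i) κ).map_eq_zero_iff]
    funext a i
    rw [← key, ht]
    simp
  · intro u
    refine ⟨(TensorProduct.comm R _ _ ≪≫ₗ TensorProduct.piScalarRight R R (∀ i, L i) κ).symm
      fun a i => (TensorProduct.comm R _ _ ≪≫ₗ TensorProduct.piScalarRight R R (L i) κ) (u i) a, ?_⟩
    funext i
    apply (TensorProduct.comm R _ _ ≪≫ₗ TensorProduct.piScalarRight R R (L i) κ).injective
    funext a
    rw [key, LinearEquiv.apply_symm_apply]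

theorem piRightHom_naturality {ι : Type*} (L : ι → Type*) [∀ i, AddCommGroup (L i)]
    [∀ i, Module R (L i)] {X Y : Type*} [AddCommGroup X] [Module R X] [AddCommGroup Y] [Module R Y]
    (f : X →ₗ[R] Y) (t : X ⊗[R] (∀ i, L i)) (i : ι) :
    TensorProduct.piRightHom R R Y L (f.rTensor _ t) i =
      f.rTensor _ (TensorProduct.piRightHom R R X L t i) := by
  induction t with
  | zero => simp
  | add s t hs ht => simp only [map_add, Pi.add_apply, hs, ht]
  | tmul x y => simp

theorem piRightHom_injective_of_finite [IsNoetherianRing R] {ι : Type*} (L : ι → Type*)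
    [∀ i, AddCommGroup (L i)] [∀ i, Module R (L i)] (X : Type*) [AddCommGroup X] [Module R X]
    [Module.Finite R X] : Function.Injective (TensorProduct.piRightHom R R X L) := by
  obtain ⟨k, p, hp⟩ := Module.Finite.exists_fin' R X
  obtain ⟨l, q', hq'⟩ := Module.Finite.exists_fin' R (LinearMap.ker p)
  let q := (LinearMap.ker p).subtype ∘ₗ q'
  have hqp : Function.Exact q p := by
    rw [LinearMap.exact_iff, LinearMap.range_comp, LinearMap.range_eq_top.mpr hq',
      Submodule.map_top, Submodule.range_subtype]
  rw [injective_iff_map_eq_zero]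
  intro t ht
  obtain ⟨s, rfl⟩ := LinearMap.rTensor_surjective _ hp t
  have hs (i : ι) : ∃ u, q.rTensor (L i) u = TensorProduct.piRightHom R R (Fin k → R) L s i := by
    refine (rTensor_exact (L i) hqp hp _).mp ?_
    rw [← piRightHom_naturality, ht]
    rfl
  choose u hu using hs
  obtain ⟨v, rfl⟩ := (piRightHom_pi_bijective L).surjective u
  have hv : q.rTensor _ v = s := by
    apply (piRightHom_pi_bijective L).injective
    funext i
    rw [piRightHom_naturality, hu]
  exact (rTensor_exact _ hqp hp s).mpr ⟨v, hv⟩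

theorem isHausdorff_tensorProduct_pi_quotient [IsNoetherianRing R] (I : Ideal R) (M X : Type*)
    [AddCommGroup M] [Module R M] [AddCommGroup X] [Module R X] [Module.Finite R X] :
    IsHausdorff I (X ⊗[R] (∀ n : ℕ, M ⧸ (I ^ n • ⊤ : Submodule R M))) := by
  refine ⟨fun t ht => piRightHom_injective_of_finite _ X ?_⟩
  rw [map_zero]
  funext n
  have h0 := apply_mem_smul_top _ (LinearMap.proj n ∘ₗ TensorProduct.piRightHom R R X
    fun n : ℕ => M ⧸ (I ^ n • ⊤ : Submodule R M)) (SModEq.zero.mp (ht n))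
  rwa [smul_top_tensorProduct_comm_eq_bot _ (smul_top_quotient_eq_bot (I ^ n) M)] at h0

end Adic

section Completion

variable {R : Type u} [CommRing R] [IsLocalRing R]
  {M : Type u} [AddCommGroup M] [Module R M]

theorem isPureMono_of_comp_completion_of [IsNoetherianRing R]
    (hM : IsTotallySeparatedModule R (AdicCompletion (maximalIdeal R) M))
    {Z : Type u} [AddCommGroup Z] [Module R Z] (f : AdicCompletion (maximalIdeal R) M →ₗ[R] Z)
    (hf : ∀ (n : ℕ) (X : Type u) [AddCommGroup X] [Module R X],
      (maximalIdeal R ^ n • ⊤ : Submodule R X) = ⊥ →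
        Function.Injective ((f ∘ₗ AdicCompletion.of (maximalIdeal R) M).lTensor X)) :
    IsPureMono R f := by
  refine isPureMono_of_finite f fun X _ _ _ => ?_
  rw [injective_iff_map_eq_zero]
  intro t ht
  refine IsHausdorff.haus (hM X) t fun n => SModEq.zero.mpr (ker_rTensor_mkQ_smul_top_le _ _ _ ?_)
  rw [LinearMap.mem_ker]
  have hbot := smul_top_quotient_eq_bot (maximalIdeal R ^ n) X
  set p := (maximalIdeal R ^ n • ⊤ : Submodule R X).mkQ
  obtain ⟨s, hs⟩ := exists_sub_lTensor_of_mem (IsNoetherian.noetherian (maximalIdeal R)) n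
    (p.rTensor (AdicCompletion (maximalIdeal R) M) t)
  rw [smul_top_tensorProduct_eq_bot _ hbot, Submodule.mem_bot, sub_eq_zero] at hs
  have h0 : (f ∘ₗ AdicCompletion.of (maximalIdeal R) M).lTensor _ s = 0 := by
    rw [LinearMap.lTensor_comp, LinearMap.comp_apply, ← hs, ← LinearMap.comp_apply,
      LinearMap.lTensor_comp_rTensor, ← LinearMap.rTensor_comp_lTensor, LinearMap.comp_apply, ht,
      map_zero]
  rw [hs, (injective_iff_map_eq_zero _).mp (hf n _ hbot) s h0, map_zero]

theorem IsTotallySeparatedModule.isPureMono_of (hM : IsTotallySeparatedModule R M) :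
    IsPureMono R (AdicCompletion.of (maximalIdeal R) M) :=
  isPureMono_of_finite _ fun X _ _ _ =>
    have := hM X
    lTensor_of_injective_of_isHausdorff _ X M

theorem IsTotallySeparatedModule.isPureMono_incl_comp_of (hM : IsTotallySeparatedModule R M) :
    IsPureMono R
      (AdicCompletion.incl (maximalIdeal R) M ∘ₗ AdicCompletion.of (maximalIdeal R) M) :=
  isPureMono_of_finite _ fun X _ _ _ =>
    have := hM X
    lTensor_incl_comp_of_injective_of_isHausdorff _ X M

theorem isTotallySeparatedModule_pi_quotient [IsNoetherianRing R] (M : Type u)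
    [AddCommGroup M] [Module R M] :
    IsTotallySeparatedModule R
      (∀ n : ℕ, M ⧸ (maximalIdeal R ^ n • ⊤ : Submodule R M)) :=
  fun X _ _ _ => isHausdorff_tensorProduct_pi_quotient _ M X

theorem IsTotallySeparatedModule.of_isPureMono {N : Type u} [AddCommGroup N] [Module R N]
    (hN : IsTotallySeparatedModule R N) {f : M →ₗ[R] N} (hf : IsPureMono R f) :
    IsTotallySeparatedModule R M :=
  fun X _ _ _ =>
    have := hN X
    isHausdorff_of_injective (f.lTensor X) (hf.2 X)

theorem isPureMono_map_of_isTotallySeparatedModule [IsNoetherianRing R]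
    (h : IsTotallySeparatedModule R (AdicCompletion (maximalIdeal R) M))
    {Y : Type u} [AddCommGroup Y] [Module R Y] {α : M →ₗ[R] Y} (hα : IsPureMono R α) :
    IsPureMono R ((AdicCompletion.map (maximalIdeal R) α).restrictScalars R) := by
  refine isPureMono_of_comp_completion_of h _ fun n X _ _ hX => ?_
  have hc : (AdicCompletion.map (maximalIdeal R) α).restrictScalars R ∘ₗ
      AdicCompletion.of (maximalIdeal R) M = AdicCompletion.of (maximalIdeal R) Y ∘ₗ α := rfl
  rw [hc, LinearMap.lTensor_comp, LinearMap.coe_comp]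
  have : IsHausdorff (maximalIdeal R) (X ⊗[R] Y) := ⟨fun x hx => by
    simpa [smul_top_tensorProduct_eq_bot Y hX] using SModEq.zero.mp (hx n)⟩
  exact (lTensor_of_injective_of_isHausdorff _ X Y).comp (hα.2 X)

theorem isStrictlyPureEssential_of_isTotallySeparatedModule [IsNoetherianRing R]
    (hM : IsTotallySeparatedModule R M)
    (h : IsTotallySeparatedModule R (AdicCompletion (maximalIdeal R) M)) :
    IsStrictlyPureEssential R (LinearMap.range (AdicCompletion.of (maximalIdeal R) M)) := by
  have hof := hM.isPureMono_of
  have key {Y : Type u} [AddCommGroup Y] [Module R Y]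
      (g : AdicCompletion (maximalIdeal R) M →ₗ[R] Y)
      (hg : IsPureMono R
        (g ∘ₗ (LinearMap.range (AdicCompletion.of (maximalIdeal R) M)).subtype)) :
      IsPureMono R g := by
    rw [isPureMono_comp_subtype_range_iff hof.1] at hg
    exact isPureMono_of_comp_completion_of h g fun _ X _ _ _ => hg.2 X
  refine ⟨⟨?_, fun X _ hX => ?_⟩, fun Y _ _ g _ hg => key g hg⟩
  · exact (isPureMono_comp_subtype_range_iff hof.1 LinearMap.id).mpr hof
  · rw [← X.ker_mkQ, LinearMap.ker_eq_bot]
    exact (key _ hX).1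

theorem exists_equiv_of_isTotallySeparatedModule [IsNoetherianRing R]
    (h : IsTotallySeparatedModule R (AdicCompletion (maximalIdeal R) M))
    (X : Type u) [AddCommGroup X] [Module R X] [Module.Finite R X] :
    ∃ e : AdicCompletion (maximalIdeal R) (X ⊗[R] M) ≃ₗ[R]
        X ⊗[R] AdicCompletion (maximalIdeal R) M,
      e.toLinearMap ∘ₗ AdicCompletion.of (maximalIdeal R) (X ⊗[R] M) =
        LinearMap.lTensor X (AdicCompletion.of (maximalIdeal R) M) := by
  have hI : (maximalIdeal R).FG := IsNoetherian.noetherian _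
  have := h X
  have := AdicCompletion.isPrecomplete_tensorProduct hI X M
  have : IsAdicComplete (maximalIdeal R) (X ⊗[R] AdicCompletion (maximalIdeal R) M) := { }
  refine ⟨LinearEquiv.ofBijective
    ((AdicCompletion.map (maximalIdeal R)
      ((AdicCompletion.of (maximalIdeal R) M).lTensor X)).restrictScalars R)
    (AdicCompletion.map_lTensor_of_bijective hI X M) ≪≫ₗ
      (AdicCompletion.ofLinearEquiv (maximalIdeal R) _).symm, ?_⟩
  refine LinearMap.ext fun t => ?_
  exact AdicCompletion.ofLinearEquiv_symm_of (maximalIdeal R) _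

theorem isPureMono_incl_of_isPureMono_map [IsNoetherianRing R]
    (h : IsPureMono R ((AdicCompletion.map (maximalIdeal R)
      (AdicCompletion.incl (maximalIdeal R) M ∘ₗ
        AdicCompletion.of (maximalIdeal R) M)).restrictScalars R)) :
    IsPureMono R (AdicCompletion.incl (maximalIdeal R) M) := by
  have hc : (AdicCompletion.map (maximalIdeal R)
      (AdicCompletion.incl (maximalIdeal R) M ∘ₗ
        AdicCompletion.of (maximalIdeal R) M)).restrictScalars R =
      AdicCompletion.of (maximalIdeal R) _ ∘ₗ AdicCompletion.incl (maximalIdeal R) M := by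
    refine LinearMap.ext fun x => AdicCompletion.ext fun n => ?_
    obtain ⟨z, hz⟩ := Submodule.mkQ_surjective _ (AdicCompletion.eval (maximalIdeal R) M n x)
    have hx : x - AdicCompletion.of (maximalIdeal R) M z ∈
        (maximalIdeal R ^ n • ⊤ : Submodule R (AdicCompletion (maximalIdeal R) M)) := by
      rw [AdicCompletion.pow_smul_top_eq_ker_eval (IsNoetherian.noetherian _), LinearMap.mem_ker,
        map_sub, AdicCompletion.eval_of, hz, sub_self]
    have hx' := apply_mem_smul_top _ (AdicCompletion.incl (maximalIdeal R) M) hx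
    rw [map_sub] at hx'
    have h1 := (Submodule.Quotient.eq _).mpr hx'
    refine Eq.trans ?_ h1.symm
    change LinearMap.reduceModIdeal _ _ (AdicCompletion.eval (maximalIdeal R) M n x) = _
    rw [← hz]
    rfl
  rw [hc] at h
  exact h.of_comp

end Completion

/-- For a totally separated module `M` the following are equivalent:
(i) `M^` is totally separated; (ii) `M ⊆ M^` is strictly pure-essential; (iii) for every
finitely generated `X` the canonical map `(X ⊗ M)^ → X ⊗ M^` is an isomorphism; (iv) for
every pure monomorphism `α : M → Y` with `Y` separated, `α^ : M^ → Y^` is a pure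
monomorphism. -/
theorem totallySeparated_completion_tfae (R : Type u) [CommRing R] [IsNoetherianRing R]
    [IsLocalRing R] (M : Type u) [AddCommGroup M] [Module R M]
    (hM : IsTotallySeparatedModule R M) :
    List.TFAE [
      IsTotallySeparatedModule R (AdicCompletion (maximalIdeal R) M),
      IsStrictlyPureEssential R (LinearMap.range (AdicCompletion.of (maximalIdeal R) M)),
      ∀ (X : Type u) [AddCommGroup X] [Module R X] [Module.Finite R X],
        ∃ e : AdicCompletion (maximalIdeal R) (X ⊗[R] M) ≃ₗ[R]
            X ⊗[R] AdicCompletion (maximalIdeal R) M,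
          e.toLinearMap ∘ₗ AdicCompletion.of (maximalIdeal R) (X ⊗[R] M) =
            LinearMap.lTensor X (AdicCompletion.of (maximalIdeal R) M),
      ∀ (Y : Type u) [AddCommGroup Y] [Module R Y] (α : M →ₗ[R] Y),
        IsHausdorff (maximalIdeal R) Y → IsPureMono R α →
          IsPureMono R ((AdicCompletion.map (maximalIdeal R) α).restrictScalars R)] := by
  tfae_have 1 → 2 := isStrictlyPureEssential_of_isTotallySeparatedModule hM
  tfae_have 2 → 1 := fun h =>
    (isTotallySeparatedModule_pi_quotient M).of_isPureMono
      (h.2 _ (AdicCompletion.incl (maximalIdeal R) M) Subtype.val_injective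
        ((isPureMono_comp_subtype_range_iff hM.isPureMono_of.1 _).mpr hM.isPureMono_incl_comp_of))
  tfae_have 1 → 3 := fun h X _ _ _ => exists_equiv_of_isTotallySeparatedModule h X
  tfae_have 3 → 1 := by
    intro h X _ _ _
    obtain ⟨e, -⟩ := h X
    exact isHausdorff_of_injective e.symm.toLinearMap e.symm.injective
  tfae_have 1 → 4 := fun h Y _ _ α _ hα => isPureMono_map_of_isTotallySeparatedModule h hα
  tfae_have 4 → 1 := by
    intro h
    have hY := isTotallySeparatedModule_pi_quotient (R := R) M
    have := hY R
    exact hY.of_isPureMono (isPureMono_incl_of_isPureMono_map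
      (h _ _ (isHausdorff_of_injective (TensorProduct.lid R _).symm.toLinearMap
        (TensorProduct.lid R _).symm.injective) hM.isPureMono_incl_comp_of))
  tfae_finish
end

section
/- Let $M \subseteq A$ be an extension of $R$-modules such that $A$ is separated and $M$ is pure and dense in $A$. Let $\mathfrak c$ be an ideal of $R$ such that $A/M$ is not $\mathfrak c$-divisible (i.e. $\mathfrak c\cdot(A/M) \neq A/M$) and $\mathfrak c$ contains an element that is a nonzerodivisor on $A$. Then $B := M + \mathfrak c A$ is a module between $M$ and $A$ such that $M$ is pure and dense in $B$, but $B$ is not pure in $A$; in particular $M$ is not strictly pure-essential in $B$ and $B$ is not totally separated. -/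
/- Throughout, `(R, 𝔪)` is a commutative noetherian local ring and all modules are `R`-modules.
`AdicCompletion (maximalIdeal R) M` is the `𝔪`-adic completion `lim M/𝔪^n M` and
`IsHausdorff (maximalIdeal R) M` says that `M` is (`𝔪`-adically) separated. -/

open TensorProduct IsLocalRing

universe u

/-- If `1 ⊗ b` vanishes in `R ⧸ (r) ⊗ N`, then `b` is a multiple of `r`. -/
theorem exists_smul_eq_of_one_tmul_eq_zero {R N : Type*} [CommRing R] [AddCommGroup N]
    [Module R N] (r : R) (b : N) (h : (1 : R ⧸ Ideal.span {r}) ⊗ₜ[R] b = 0) :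
    ∃ b' : N, r • b' = b := by
  have h' := congrArg (TensorProduct.quotTensorEquivQuotSMul N (Ideal.span {r})) h
  rw [map_zero, ← map_one (Ideal.Quotient.mk (Ideal.span {r})),
    TensorProduct.quotTensorEquivQuotSMul_mk_tmul, one_smul, Submodule.Quotient.mk_eq_zero,
    Submodule.ideal_span_singleton_smul] at h'
  obtain ⟨b', -, hb'⟩ := (Submodule.mem_smul_pointwise_iff_exists _ _ _).1 h'
  exact ⟨b', hb'⟩

/-- In `R ⧸ (r) ⊗ N`, multiples of `r` become zero. -/
theorem one_tmul_smul_eq_zero {R N : Type*} [CommRing R] [AddCommGroup N] [Module R N]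
    (r : R) (b : N) : (1 : R ⧸ Ideal.span {r}) ⊗ₜ[R] (r • b) = 0 := by
  have hr : r • (1 : R ⧸ Ideal.span {r}) = 0 := by
    rw [Algebra.smul_def, mul_one]
    exact Ideal.Quotient.eq_zero_iff_mem.2 (Ideal.mem_span_singleton_self r)
  rw [← TensorProduct.smul_tmul, hr, TensorProduct.zero_tmul]

/-- A submodule which is dense modulo `I` is dense modulo every power of `I`. -/
theorem sup_pow_smul_top_eq_top {R N : Type*} [CommRing R] [AddCommGroup N] [Module R N]
    (I : Ideal R) (M : Submodule R N) (h : M ⊔ I • (⊤ : Submodule R N) = ⊤) (n : ℕ) :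
    M ⊔ I ^ n • (⊤ : Submodule R N) = ⊤ := by
  induction n with
  | zero => simp
  | succ n ih =>
    refine top_le_iff.1 ?_
    calc (⊤ : Submodule R N) = M ⊔ I • (M ⊔ I ^ n • (⊤ : Submodule R N)) := by rw [ih, h]
      _ = M ⊔ (I • M ⊔ I ^ (n + 1) • (⊤ : Submodule R N)) := by
        rw [Submodule.smul_sup, ← Submodule.mul_smul, pow_succ']
      _ ≤ M ⊔ I ^ (n + 1) • (⊤ : Submodule R N) :=
        sup_le le_sup_left (sup_le (Submodule.smul_le_right.trans le_sup_left) le_sup_right)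

/-- The composite `M ⊆ B ⊆ A` is pure when `M` is pure in `A`. -/
theorem IsPureMono.subtype_comp_comap_subtype {R : Type u} [CommRing R] {A : Type u}
    [AddCommGroup A] [Module R A] {M B : Submodule R A} (hM : IsPureMono R M.subtype)
    (hMB : M ≤ B) : IsPureMono R (B.subtype ∘ₗ (M.comap B.subtype).subtype) := by
  refine ⟨B.subtype_injective.comp (Submodule.subtype_injective _), fun X _ _ => ?_⟩
  let e : M.comap B.subtype ≃ₗ[R] M := Submodule.comapSubtypeEquivOfLe hMB
  have he : B.subtype ∘ₗ (M.comap B.subtype).subtype = M.subtype ∘ₗ e.toLinearMap := rfl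
  rw [he, LinearMap.lTensor_comp, LinearMap.coe_comp]
  exact (hM.2 X).comp (LinearEquiv.lTensor X e).injective

/-- A submodule that is pure in an overmodule is pure in every intermediate module. -/
theorem IsPureMono.comap_subtype {R : Type u} [CommRing R] {A : Type u} [AddCommGroup A]
    [Module R A] {M B : Submodule R A} (hM : IsPureMono R M.subtype) (hMB : M ≤ B) :
    IsPureMono R (M.comap B.subtype).subtype := by
  refine ⟨Submodule.subtype_injective _, fun X _ _ => ?_⟩
  have hcomp := (hM.subtype_comp_comap_subtype hMB).2 X
  rw [LinearMap.lTensor_comp, LinearMap.coe_comp] at hcomp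
  exact hcomp.of_comp

/-- If `M` is dense in `A`, then it is dense in `M + 𝔠A`. -/
theorem comap_subtype_sup_smul_top_eq_top {R A : Type*} [CommRing R] [AddCommGroup A]
    [Module R A] (I c : Ideal R) (M B : Submodule R A)
    (hM : M ⊔ I • (⊤ : Submodule R A) = ⊤) (hB : B = M ⊔ c • (⊤ : Submodule R A)) :
    M.comap B.subtype ⊔ I • (⊤ : Submodule R B) = ⊤ := by
  have hMB : M ≤ B := hB ▸ le_sup_left
  have hcB : c • (⊤ : Submodule R A) ≤ B := hB ▸ le_sup_right
  apply Submodule.map_injective_of_injective B.subtype_injective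
  rw [Submodule.map_sup, Submodule.map_comap_subtype, Submodule.map_smul'', Submodule.map_top,
    Submodule.range_subtype, inf_eq_right.2 hMB]
  refine le_antisymm (sup_le hMB Submodule.smul_le_right) ?_
  calc B = M ⊔ c • (M ⊔ I • (⊤ : Submodule R A)) := by rw [hM, hB]
    _ = M ⊔ (c • M ⊔ I • c • (⊤ : Submodule R A)) := by
      rw [Submodule.smul_sup, ← Submodule.mul_smul, ← Submodule.mul_smul, mul_comm]
    _ ≤ M ⊔ I • B := sup_le le_sup_left (sup_le (Submodule.smul_le_right.trans le_sup_left)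
      ((smul_mono_right I hcB).trans le_sup_right))

/-- Let `M ⊆ A` with `A` separated, `M` pure and dense in `A`, and let `𝔠`
be an ideal such that `A/M` is not `𝔠`-divisible and `𝔠` contains a nonzerodivisor on `A`.
Then `B := M + 𝔠A` lies between `M` and `A`, `M` is pure and dense in `B`, but `B` is not
pure in `A`; in particular `M` is not strictly pure-essential in `B` and `B` is not totally
separated. -/
theorem not_strictlyPureEssential_of_ideal (R : Type u) [CommRing R] [IsNoetherianRing R]
    [IsLocalRing R] (A : Type u) [AddCommGroup A] [Module R A]
    (hA : IsHausdorff (maximalIdeal R) A) (M : Submodule R A)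
    (hpure : IsPureMono R M.subtype)
    (hdense : M ⊔ maximalIdeal R • (⊤ : Submodule R A) = ⊤)
    (c : Ideal R)
    (hndiv : M ⊔ c • (⊤ : Submodule R A) ≠ ⊤)
    (hreg : ∃ r ∈ c, ∀ x : A, r • x = 0 → x = 0) :
    ∃ B : Submodule R A, B = M ⊔ c • (⊤ : Submodule R A) ∧ M ≤ B ∧
      IsPureMono R (M.comap B.subtype).subtype ∧
      M.comap B.subtype ⊔ maximalIdeal R • (⊤ : Submodule R B) = ⊤ ∧
      ¬ IsPureMono R B.subtype ∧
      ¬ IsStrictlyPureEssential R (M.comap B.subtype) ∧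
      ¬ IsTotallySeparatedModule R B := by
  obtain ⟨r, hrc, hr⟩ := hreg
  obtain ⟨B, hB⟩ : ∃ B, B = M ⊔ c • (⊤ : Submodule R A) := ⟨_, rfl⟩
  have hMB : M ≤ B := hB ▸ le_sup_left
  have hrB (x : A) : r • x ∈ B :=
    hB ▸ Submodule.mem_sup_right (Submodule.smul_mem_smul hrc Submodule.mem_top)
  obtain ⟨a, ha⟩ : ∃ a, a ∉ B := by
    by_contra! h
    exact hndiv (hB ▸ Submodule.eq_top_iff'.2 h)
  have hne : (1 : R ⧸ Ideal.span {r}) ⊗ₜ[R] (⟨r • a, hrB a⟩ : B) ≠ 0 := by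
    intro h
    obtain ⟨b, hb⟩ := exists_smul_eq_of_one_tmul_eq_zero r _ h
    have hb' : r • (b : A) = r • a := congrArg Subtype.val hb
    have hba : (b : A) = a := sub_eq_zero.1 (hr _ (by rw [smul_sub, hb', sub_self]))
    exact ha (hba ▸ b.2)
  have hnpure : ¬ IsPureMono R B.subtype := by
    intro h
    refine hne (h.2 (R ⧸ Ideal.span {r}) ?_)
    rw [map_zero, LinearMap.lTensor_tmul]
    exact one_tmul_smul_eq_zero r a
  refine ⟨B, hB, hMB, hpure.comap_subtype hMB,
    comap_subtype_sup_smul_top_eq_top _ c M B hdense hB, hnpure, fun h => ?_, fun h => ?_⟩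
  · exact hnpure (h.2 A B.subtype B.subtype_injective (hpure.subtype_comp_comap_subtype hMB))
  · refine hne ((h (R ⧸ Ideal.span {r})).haus _ fun n => ?_)
    rw [SModEq.zero]
    obtain ⟨m, hm, y, hy, rfl⟩ := Submodule.mem_sup.1
      ((sup_pow_smul_top_eq_top _ M hdense n).symm ▸ Submodule.mem_top : a ∈ _)
    let f : A →ₗ[R] (R ⧸ Ideal.span {r}) ⊗[R] B :=
      TensorProduct.mk R _ B 1 ∘ₗ (LinearMap.lsmul R A r).codRestrict B hrB
    have hfm : f m = 0 := one_tmul_smul_eq_zero r (⟨m, hMB hm⟩ : B)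
    change f (m + y) ∈ _
    rw [map_add, hfm, zero_add]
    have hfy := Submodule.mem_map_of_mem (f := f) hy
    rw [Submodule.map_smul''] at hfy
    exact Submodule.smul_mono le_rfl le_top hfy
end

section
/- Let $(M_i)_{i\in I}$ be a family of $R$-modules, $M = \bigoplus_{i\in I} M_i$, $P = \prod_{i\in I} M_i$, $A = \bigcap_{n\ge 1}(M + \mathfrak m^n P)$, and let $\mathfrak b$ be an open ideal of $R$, i.e. $\mathfrak m^e \subseteq \mathfrak b$ for some $e \ge 1$. Then $A \cap \mathfrak b P = \mathfrak b A + H(P)$ and $A = M + \mathfrak b A + H(P)$, where $H(P) = \bigcap_{n\ge 1}\mathfrak m^n P$. -/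
/- Throughout, `(R, 𝔪)` is a commutative noetherian local ring and all modules are `R`-modules.
`AdicCompletion (maximalIdeal R) M` is the `𝔪`-adic completion `lim M/𝔪^n M` and
`IsHausdorff (maximalIdeal R) M` says that `M` is (`𝔪`-adically) separated. -/

open TensorProduct IsLocalRing

universe u

/-- Membership in `I • N` for an ideal with a given finite family of generators. -/
theorem exists_sum_of_mem_span_smul {R N κ : Type*} [CommRing R] [AddCommGroup N] [Module R N]
    [Fintype κ] (g : κ → R) (Q : Submodule R N) {x : N}
    (hx : x ∈ Ideal.span (Set.range g) • Q) :
    ∃ y : κ → N, (∀ j, y j ∈ Q) ∧ x = ∑ j, g j • y j := by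
  induction hx using Submodule.smul_induction_on' with
  | smul r hr n hn =>
    obtain ⟨c, rfl⟩ := (Submodule.mem_span_range_iff_exists_fun R).1 hr
    refine ⟨fun j => c j • n, fun j => Q.smul_mem _ hn, ?_⟩
    simp only [Finset.sum_smul, smul_smul, smul_eq_mul, mul_comm]
  | add a _ b _ ha hb =>
    obtain ⟨y, hy, rfl⟩ := ha
    obtain ⟨z, hz, rfl⟩ := hb
    exact ⟨y + z, fun j => Q.add_mem (hy j) (hz j), by simp [Finset.sum_add_distrib]⟩

theorem Ideal.FG.exists_fintype_span_range {R : Type*} [CommRing R] {I : Ideal R} (hI : I.FG) :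
    ∃ (k : ℕ) (g : Fin k → R), Ideal.span (Set.range g) = I :=
  Submodule.fg_iff_exists_fin_generating_family.1 hI

section Pi

variable {R ι : Type*} [CommRing R] {M : ι → Type*}
  [∀ i, AddCommGroup (M i)] [∀ i, Module R (M i)]

/-- A finitely generated ideal acts coordinatewise on a product of modules. -/
theorem mem_smul_top_pi_iff {I : Ideal R} (hI : I.FG) (x : (i : ι) → M i) :
    x ∈ I • (⊤ : Submodule R ((i : ι) → M i)) ↔
      ∀ i, x i ∈ I • (⊤ : Submodule R (M i)) := by
  constructor
  · intro hx i
    have h := Submodule.mem_map_of_mem (f := LinearMap.proj (R := R) (φ := M) i) hx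
    rw [Submodule.map_smul''] at h
    exact Submodule.smul_mono le_rfl le_top h
  · intro hx
    obtain ⟨k, g, rfl⟩ := hI.exists_fintype_span_range
    choose y _ hy using fun i => exists_sum_of_mem_span_smul g _ (hx i)
    have : x = ∑ j, g j • (fun i => y i j) := by
      ext i
      simp [hy i]
    rw [this]
    exact Submodule.sum_mem _ fun j _ =>
      Submodule.smul_mem_smul (Ideal.subset_span ⟨j, rfl⟩) trivial

theorem mem_iSup_range_single_iff [DecidableEq ι] (x : (i : ι) → M i) :
    x ∈ ⨆ i, LinearMap.range (LinearMap.single R M i) ↔ {i | x i ≠ 0}.Finite := by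
  constructor
  · intro hx
    induction hx using Submodule.iSup_induction' with
    | mem i x hx =>
      obtain ⟨m, rfl⟩ := hx
      refine (Set.finite_singleton i).subset fun j hj => ?_
      by_contra hne
      exact hj (by simp [Pi.single_eq_of_ne (show j ≠ i from hne)])
    | zero => simp
    | add x y _ _ hx hy =>
      refine (hx.union hy).subset fun i hi => ?_
      by_contra h
      simp only [Set.mem_union, Set.mem_ofPred_eq, not_or, not_not] at h
      exact hi (by simp [h.1, h.2])
  · intro hx
    have : x = ∑ i ∈ hx.toFinset, LinearMap.single R M i (x i) := by
      ext i
      rw [Finset.sum_apply]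
      by_cases hi : x i = 0
      · rw [hi, Finset.sum_eq_zero]
        intro j _
        by_cases hj : i = j
        · subst hj; simp [hi]
        · simp [Pi.single_eq_of_ne hj]
      · rw [Finset.sum_eq_single i]
        · simp
        · intro j _ hj
          simp [Pi.single_eq_of_ne hj.symm]
        · simp [hi]
    rw [this]
    exact Submodule.sum_mem _ fun i _ =>
      Submodule.mem_iSup_of_mem i (LinearMap.mem_range_self _ _)

/-- `x` lies in `⨁ M i + I • ∏ M i` iff almost all coordinates of `x` lie in `I • M i`. -/
theorem mem_iSup_range_single_sup_smul_top_iff [DecidableEq ι] {I : Ideal R} (hI : I.FG)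
    (x : (i : ι) → M i) :
    x ∈ (⨆ i, LinearMap.range (LinearMap.single R M i)) ⊔ I • (⊤ : Submodule R ((i : ι) → M i)) ↔
      {i | x i ∉ I • (⊤ : Submodule R (M i))}.Finite := by
  classical
  constructor
  · intro hx
    obtain ⟨y, hy, z, hz, rfl⟩ := Submodule.mem_sup.1 hx
    rw [mem_iSup_range_single_iff] at hy
    rw [mem_smul_top_pi_iff hI] at hz
    refine hy.subset fun i hi h0 => hi ?_
    simpa [h0] using hz i
  · intro hx
    refine Submodule.mem_sup.2
      ⟨fun i => if x i ∈ I • (⊤ : Submodule R (M i)) then 0 else x i, ?_,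
        fun i => if x i ∈ I • (⊤ : Submodule R (M i)) then x i else 0, ?_, ?_⟩
    · rw [mem_iSup_range_single_iff]
      refine hx.subset fun i hi h => hi (by simp [h])
    · rw [mem_smul_top_pi_iff hI]
      intro i
      split_ifs with h
      · exact h
      · exact Submodule.zero_mem _
    · ext i
      by_cases h : x i ∈ I • (⊤ : Submodule R (M i)) <;> simp [h]

end Pi

/-- If `𝔞 ^ e ≤ (g)`, an element `x ∈ (g) N` is, up to an element of `⋂ 𝔞 ^ n N`, a combination
of the generators whose coefficients are at most `e` steps less divisible than `x`. -/
theorem exists_sum_add_of_mem_span_smul_top {R N κ : Type*} [CommRing R] [AddCommGroup N]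
    [Module R N] [Fintype κ] (g : κ → R) {𝔞 : Ideal R} {e : ℕ}
    (he : 𝔞 ^ e ≤ Ideal.span (Set.range g)) {x : N}
    (hx : x ∈ Ideal.span (Set.range g) • (⊤ : Submodule R N)) :
    ∃ (y : κ → N) (h : N), x = ∑ j, g j • y j + h ∧
      (∀ n : ℕ, h ∈ 𝔞 ^ n • (⊤ : Submodule R N)) ∧
      ∀ n : ℕ, x ∈ 𝔞 ^ (n + e) • (⊤ : Submodule R N) →
        ∀ j, y j ∈ 𝔞 ^ n • (⊤ : Submodule R N) := by
  classical
  by_cases hall : ∀ n : ℕ, x ∈ 𝔞 ^ n • (⊤ : Submodule R N)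
  · exact ⟨0, x, by simp, hall, fun n _ j => Submodule.zero_mem _⟩
  have hanti {m n : ℕ} (h : m ≤ n) : 𝔞 ^ n • (⊤ : Submodule R N) ≤ 𝔞 ^ m • ⊤ :=
    Submodule.smul_mono_left (Ideal.pow_le_pow_right h)
  push Not at hall
  obtain ⟨s, hs, hmin⟩ : ∃ s, x ∉ 𝔞 ^ s • (⊤ : Submodule R N) ∧
      ∀ t < s, x ∈ 𝔞 ^ t • (⊤ : Submodule R N) :=
    ⟨Nat.find hall, Nat.find_spec hall, fun t ht => not_not.1 (Nat.find_min hall ht)⟩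
  have hmem : x ∈ Ideal.span (Set.range g) • (𝔞 ^ (s - 1 - e) • (⊤ : Submodule R N)) := by
    rcases le_or_gt (s - 1) e with h | h
    · simpa [Nat.sub_eq_zero_of_le h] using hx
    · have hx' := hmin (s - 1) (by omega)
      rw [← Nat.add_sub_cancel' h.le, pow_add, Submodule.mul_smul] at hx'
      exact Submodule.smul_mono_left he hx'
  obtain ⟨y, hy, hxy⟩ := exists_sum_of_mem_span_smul g _ hmem
  refine ⟨y, 0, by simpa using hxy, fun n => Submodule.zero_mem _, fun n hn j => ?_⟩
  have : n + e < s := by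
    by_contra! hle
    exact hs (hanti hle hn)
  exact hanti (by omega) (hy j)

/-- With `M = ⊕ M i ⊆ P = ∏ M i`, `A = ⋂_{n ≥ 1} (M + 𝔪^n P)` and an open
ideal `𝔟` (i.e. `𝔪^e ⊆ 𝔟` for some `e ≥ 1`), one has `A ∩ 𝔟 P = 𝔟 A + H(P)` and
`A = M + 𝔟 A + H(P)`. -/
theorem closure_inter_smul_open (R : Type u) [CommRing R] [IsNoetherianRing R] [IsLocalRing R]
    {ι : Type u} [DecidableEq ι] (M : ι → Type u)
    [∀ i, AddCommGroup (M i)] [∀ i, Module R (M i)]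
    (Md A HP : Submodule R ((i : ι) → M i))
    (hMd : Md = ⨆ i, LinearMap.range (LinearMap.single R M i))
    (hA : A = ⨅ (n : ℕ) (_ : 1 ≤ n), (Md ⊔ maximalIdeal R ^ n • ⊤))
    (hHP : HP = ⨅ (n : ℕ) (_ : 1 ≤ n),
      (maximalIdeal R ^ n • (⊤ : Submodule R ((i : ι) → M i))))
    (b : Ideal R) (e : ℕ) (he : 1 ≤ e) (hopen : maximalIdeal R ^ e ≤ b) :
    A ⊓ b • (⊤ : Submodule R ((i : ι) → M i)) = b • A ⊔ HP ∧
      A = Md ⊔ b • A ⊔ HP := by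
  have hfg (I : Ideal R) : I.FG := IsNoetherian.noetherian I
  have hAmem (x : (i : ι) → M i) : x ∈ A ↔ ∀ n, 1 ≤ n →
      {i | x i ∉ maximalIdeal R ^ n • (⊤ : Submodule R (M i))}.Finite := by
    simp only [hA, hMd, Submodule.mem_iInf, mem_iSup_range_single_sup_smul_top_iff (hfg _)]
  have hMdA : Md ≤ A := hA ▸ le_iInf₂ fun n _ => le_sup_left
  have hHPA : HP ≤ A := by
    rw [hA, hHP]
    exact iInf₂_mono fun n _ => le_sup_right
  have hHPb : HP ≤ b • ⊤ := by
    rw [hHP]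
    exact (iInf₂_le e he).trans (Submodule.smul_mono_left hopen)
  have hinter : A ⊓ b • (⊤ : Submodule R ((i : ι) → M i)) = b • A ⊔ HP := by
    refine le_antisymm ?_ (sup_le (le_inf Submodule.smul_le_right
      (Submodule.smul_mono le_rfl le_top)) (le_inf hHPA hHPb))
    rintro x ⟨hxA, hxb⟩
    obtain ⟨k, g, rfl⟩ := (hfg b).exists_fintype_span_range
    replace hxb := (mem_smul_top_pi_iff (hfg _) x).1 hxb
    choose y h hxy hh hy using fun i => exists_sum_add_of_mem_span_smul_top g hopen (hxb i)
    have hx : x = ∑ j, g j • (fun i => y i j) + h := by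
      ext i
      simp [← hxy i]
    rw [hx]
    refine Submodule.add_mem_sup (Submodule.sum_mem _ fun j _ =>
      Submodule.smul_mem_smul (Ideal.subset_span ⟨j, rfl⟩) ?_) ?_
    · refine (hAmem _).2 fun n _ => ((hAmem x).1 hxA (n + e) (by omega)).subset ?_
      exact fun i hi hxi => hi (hy i n hxi j)
    · simp only [hHP, Submodule.mem_iInf, mem_smul_top_pi_iff (hfg _)]
      exact fun n _ i => hh i n
  refine ⟨hinter, le_antisymm (fun x hx => ?_)
    (sup_le (sup_le hMdA Submodule.smul_le_right) hHPA)⟩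
  have hxe : x ∈ Md ⊔ maximalIdeal R ^ e • ⊤ := by
    rw [hA] at hx
    exact iInf₂_le (α := Submodule R _) e he hx
  obtain ⟨m, hm, p, hp, rfl⟩ := Submodule.mem_sup.1 hxe
  rw [sup_assoc, ← hinter]
  exact Submodule.add_mem_sup hm
    ⟨(A.add_mem_iff_right (hMdA hm)).1 hx, Submodule.smul_mono_left hopen hp⟩
end
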